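/- Let A_n denote the path graph on vertex set {1,…,n} with edges {i, i+1} for 1 ≤ i ≤ n−1. Then the ℚ-algebra homomorphism from the nil-Coxeter algebra N_n to E_{A_n} sending t_i to x_{i,i+1} is an algebra isomorphism; the only minimal relations in E_{A_n} are the quadratic and braid relations. In particular, for every d ≥ 0, dim_ℚ E_{A_n}^d equals the number of permutations of {1,…,n} with exactly d inversions, and dim_ℚ E_{A_n} = n!. -/

import Mathlib

open scoped TensorProduct

namespace FK

/-- Defining relations of the Fomin–Kirillov algebra `E n`, with generators indexed by
ordered pairs `(i, j)`; we also impose `x_{ii} = 0` and the antisymmetry `x_{ji} = -x_{ij}`,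
so that the generators of the algebra are the `x_{ij}` for `i < j`. -/
inductive Rel (n : ℕ) : FreeAlgebra ℚ (Fin n × Fin n) → FreeAlgebra ℚ (Fin n × Fin n) → Prop
  | diag (i : Fin n) : Rel n (FreeAlgebra.ι ℚ (i, i)) 0
  | antisymm (i j : Fin n) (hij : i ≠ j) :
      Rel n (FreeAlgebra.ι ℚ (j, i)) (-FreeAlgebra.ι ℚ (i, j))
  | square (i j : Fin n) (hij : i ≠ j) :
      Rel n (FreeAlgebra.ι ℚ (i, j) * FreeAlgebra.ι ℚ (i, j)) 0
  | comm (i j k l : Fin n) (h : List.Nodup [i, j, k, l]) :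
      Rel n (FreeAlgebra.ι ℚ (i, j) * FreeAlgebra.ι ℚ (k, l))
        (FreeAlgebra.ι ℚ (k, l) * FreeAlgebra.ι ℚ (i, j))
  | cyclic (i j k : Fin n) (h : List.Nodup [i, j, k]) :
      Rel n (FreeAlgebra.ι ℚ (i, j) * FreeAlgebra.ι ℚ (j, k)
        + FreeAlgebra.ι ℚ (j, k) * FreeAlgebra.ι ℚ (k, i)
        + FreeAlgebra.ι ℚ (k, i) * FreeAlgebra.ι ℚ (i, j)) 0

/-- The Fomin–Kirillov algebra `E n`. -/
abbrev E (n : ℕ) : Type := RingQuot (Rel n)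

/-- The generator `x_{ij}` of `E n`. -/
noncomputable def x (n : ℕ) (i j : Fin n) : E n :=
  RingQuot.mkAlgHom ℚ (Rel n) (FreeAlgebra.ι ℚ (i, j))

/-- The product of generators `x_{i₁j₁} ⋯ x_{i_d j_d}` given by a list of pairs. -/
noncomputable def word (n : ℕ) (l : List (Fin n × Fin n)) : E n :=
  (l.map fun p => x n p.1 p.2).prod

/-- The degree-`d` component of `E n`: the span of products of `d` generators. -/
def degSpan (n : ℕ) (d : ℕ) : Submodule ℚ (E n) :=
  Submodule.span ℚ {y | ∃ l : List (Fin n × Fin n),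
    (∀ p ∈ l, p.1 ≠ p.2) ∧ l.length = d ∧ y = word n l}

/-- The Fomin–Kirillov algebra of a graph `G`: the subalgebra of `E n` generated by the
`x_{ij}` with `{i,j}` an edge of `G`. -/
def EG (n : ℕ) (G : SimpleGraph (Fin n)) : Subalgebra ℚ (E n) :=
  Algebra.adjoin ℚ {y | ∃ i j : Fin n, G.Adj i j ∧ y = x n i j}

/-- The degree-`d` component `E_G^d = E_G ∩ E_n^d`. -/
def EGdeg (n : ℕ) (G : SimpleGraph (Fin n)) (d : ℕ) : Submodule ℚ (E n) :=
  (EG n G).toSubmodule ⊓ degSpan n d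

/-- The positive-degree part `E_G⁺` of `E_G`. -/
def EGplus (n : ℕ) (G : SimpleGraph (Fin n)) : Submodule ℚ (E n) :=
  ⨆ d : ℕ, ⨆ _ : 1 ≤ d, EGdeg n G d


/-- Defining relations of the nil-Coxeter algebra of type `A_{m}` on generators
`t_0, …, t_{m-1}`. -/
inductive NCRel (m : ℕ) : FreeAlgebra ℚ (Fin m) → FreeAlgebra ℚ (Fin m) → Prop
  | square (i : Fin m) : NCRel m (FreeAlgebra.ι ℚ i * FreeAlgebra.ι ℚ i) 0
  | comm (i j : Fin m) (h : (i : ℕ) + 2 ≤ (j : ℕ) ∨ (j : ℕ) + 2 ≤ (i : ℕ)) :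
      NCRel m (FreeAlgebra.ι ℚ i * FreeAlgebra.ι ℚ j)
        (FreeAlgebra.ι ℚ j * FreeAlgebra.ι ℚ i)
  | braid (i j : Fin m) (h : (j : ℕ) = (i : ℕ) + 1) :
      NCRel m (FreeAlgebra.ι ℚ i * FreeAlgebra.ι ℚ j * FreeAlgebra.ι ℚ i)
        (FreeAlgebra.ι ℚ j * FreeAlgebra.ι ℚ i * FreeAlgebra.ι ℚ j)

/-- The nil-Coxeter algebra `N` with `m` generators (type `A_m`). -/
abbrev NC (m : ℕ) : Type := RingQuot (NCRel m)

/-- The generator `t_i` of the nil-Coxeter algebra. -/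
noncomputable def nt (m : ℕ) (i : Fin m) : NC m :=
  RingQuot.mkAlgHom ℚ (NCRel m) (FreeAlgebra.ι ℚ i)

/-- The path graph `A_n` on `{1,…,n}` with edges `{i, i+1}`. -/
def pathA (n : ℕ) : SimpleGraph (Fin n) :=
  SimpleGraph.fromRel fun i j => (j : ℕ) = (i : ℕ) + 1

/-- The number of inversions of a permutation. -/
def inversions (n : ℕ) (σ : Equiv.Perm (Fin n)) : ℕ :=
  (Finset.univ.filter fun p : Fin n × Fin n => p.1 < p.2 ∧ σ p.2 < σ p.1).card

/-! ### Simple transpositions and inversions -/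

/-- Left endpoint of the `i`-th edge. -/
def lo {n : ℕ} (i : Fin (n - 1)) : Fin n := ⟨(i : ℕ), by have := i.2; omega⟩
/-- Right endpoint of the `i`-th edge. -/
def hi {n : ℕ} (i : Fin (n - 1)) : Fin n := ⟨(i : ℕ) + 1, by have := i.2; omega⟩
/-- The simple transposition. -/
def sw {n : ℕ} (i : Fin (n - 1)) : Equiv.Perm (Fin n) := Equiv.swap (lo i) (hi i)

lemma lo_val {n : ℕ} (i : Fin (n - 1)) : ((lo i : Fin n) : ℕ) = i := rfl
lemma hi_val {n : ℕ} (i : Fin (n - 1)) : ((hi i : Fin n) : ℕ) = i + 1 := rfl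

lemma lo_ne_hi {n : ℕ} (i : Fin (n - 1)) : (lo i : Fin n) ≠ hi i := by
  intro h
  have := congrArg Fin.val h
  simp [lo, hi] at this

lemma sw_val {n : ℕ} (i : Fin (n - 1)) (p : Fin n) :
    ((sw i p : Fin n) : ℕ) = if (p : ℕ) = i then (i : ℕ) + 1 else if (p : ℕ) = i + 1 then i else p := by
  unfold sw
  rw [Equiv.swap_apply_def]
  simp only [Fin.ext_iff, lo_val, hi_val]
  split_ifs <;> simp_all [lo_val, hi_val]

lemma sw_mul_self {n : ℕ} (i : Fin (n - 1)) : (sw i : Equiv.Perm (Fin n)) * sw i = 1 :=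
  Equiv.swap_mul_self _ _

lemma mul_sw_sw {n : ℕ} (w : Equiv.Perm (Fin n)) (i : Fin (n - 1)) : w * sw i * sw i = w := by
  rw [mul_assoc, sw_mul_self, mul_one]

lemma sw_sw {n : ℕ} (i : Fin (n - 1)) (p : Fin n) : sw i (sw i p) = p := by
  simp [sw]

/-- `i` is a descent of `w`. -/
def Desc {n : ℕ} (w : Equiv.Perm (Fin n)) (i : Fin (n - 1)) : Prop := w (hi i) < w (lo i)

lemma inv_desc {n : ℕ} (w : Equiv.Perm (Fin n)) (i : Fin (n - 1)) (h : Desc w i) :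
    inversions n (w * sw i) + 1 = inversions n w := by
  unfold inversions
  have hmem : (lo i, hi i) ∈ (Finset.univ.filter fun p : Fin n × Fin n =>
      p.1 < p.2 ∧ w p.2 < w p.1) := by
    simp only [Finset.mem_filter, Finset.mem_univ, true_and]
    exact ⟨by simp [Fin.lt_def, lo_val, hi_val], h⟩
  rw [← Finset.card_erase_add_one hmem]
  congr 1
  have hlt : ∀ p q : Fin n, p < q → ¬ (p = lo i ∧ q = hi i) → sw i p < sw i q := by
    intro p q hpq hne
    rw [Fin.lt_def] at hpq ⊢
    rw [Fin.ext_iff, Fin.ext_iff, lo_val, hi_val] at hne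
    rw [sw_val, sw_val]
    split_ifs <;> omega
  have hlo : sw i (lo i) = hi i := by simp [sw]
  have hhi : sw i (hi i) = lo i := by simp [sw]
  refine Finset.card_bij (fun p _ => (sw i p.1, sw i p.2)) ?_ ?_ ?_
  · rintro ⟨p, q⟩ hp
    simp only [Finset.mem_filter, Finset.mem_univ, true_and, Finset.mem_erase] at hp ⊢
    rw [Equiv.Perm.mul_apply, Equiv.Perm.mul_apply] at hp
    have hne : ¬ (p = lo i ∧ q = hi i) := by
      rintro ⟨rfl, rfl⟩
      rw [hlo, hhi] at hp
      exact lt_asymm h hp.2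
    refine ⟨?_, hlt p q hp.1 hne, hp.2⟩
    intro he
    rw [Prod.mk.injEq] at he
    have h1 : p = hi i := by rw [← sw_sw i p, he.1, hlo]
    have h2 : q = lo i := by rw [← sw_sw i q, he.2, hhi]
    have := hp.1
    rw [h1, h2, Fin.lt_def, lo_val, hi_val] at this
    omega
  · rintro ⟨p, q⟩ _ ⟨p', q'⟩ _ he
    simpa using he
  · rintro ⟨p, q⟩ hp
    simp only [Finset.mem_filter, Finset.mem_univ, true_and, Finset.mem_erase, ne_eq,
      Prod.mk.injEq] at hp
    refine ⟨(sw i p, sw i q), ?_, by simp [sw_sw]⟩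
    simp only [Finset.mem_filter, Finset.mem_univ, true_and]
    rw [Equiv.Perm.mul_apply, Equiv.Perm.mul_apply, sw_sw, sw_sw]
    exact ⟨hlt p q hp.2.1 hp.1, hp.2.2⟩

lemma desc_or {n : ℕ} (w : Equiv.Perm (Fin n)) (i : Fin (n - 1)) (h : ¬ Desc w i) :
    Desc (w * sw i) i := by
  unfold Desc at *
  have hlo : sw i (lo i) = hi i := by simp [sw]
  have hhi : sw i (hi i) = lo i := by simp [sw]
  rw [Equiv.Perm.mul_apply, Equiv.Perm.mul_apply, hlo, hhi]
  refine lt_of_le_of_ne (not_lt.mp h) ?_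
  intro he
  exact lo_ne_hi i (w.injective he)

lemma inv_le {n : ℕ} (w : Equiv.Perm (Fin n)) (i : Fin (n - 1)) :
    inversions n w ≤ inversions n (w * sw i) + 1 := by
  by_cases h : Desc w i
  · rw [inv_desc w i h]
  · have := inv_desc _ i (desc_or w i h)
    rw [mul_sw_sw] at this
    omega

lemma eq_one_of_no_desc {n : ℕ} (w : Equiv.Perm (Fin n)) (h : ¬ ∃ i, Desc w i) : w = 1 := by
  have hmono : StrictMono w := by
    cases n with
    | zero => intro a; exact a.elim0
    | succ m =>
      rw [Fin.strictMono_iff_lt_succ]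
      intro i
      by_contra hc
      refine h ⟨⟨i, by have := i.2; omega⟩, ?_⟩
      refine lt_of_le_of_ne (not_lt.mp hc) ?_
      intro he
      exact lo_ne_hi _ (w.injective he).symm
  have : (w : Fin n → Fin n) = id := by
    refine (StrictMono.range_inj hmono strictMono_id).1 ?_
    simp [w.surjective.range_eq]
  ext p
  exact congrArg Fin.val (congrFun this p)

/-! ### The standard basis of the nil-Coxeter algebra -/

lemma nt_sq (m : ℕ) (i : Fin m) : nt m i * nt m i = 0 := by
  have := RingQuot.mkAlgHom_rel ℚ (NCRel.square i)
  simpa [nt] using this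

lemma nt_comm (m : ℕ) (i j : Fin m) (h : (i : ℕ) + 2 ≤ (j : ℕ) ∨ (j : ℕ) + 2 ≤ (i : ℕ)) :
    nt m i * nt m j = nt m j * nt m i := by
  have := RingQuot.mkAlgHom_rel ℚ (NCRel.comm i j h)
  simpa [nt] using this

lemma nt_braid (m : ℕ) (i j : Fin m) (h : (j : ℕ) = (i : ℕ) + 1) :
    nt m i * nt m j * nt m i = nt m j * nt m i * nt m j := by
  have := RingQuot.mkAlgHom_rel ℚ (NCRel.braid i j h)
  simpa [nt] using this

open Classical in
/-- The basis element of `N_n` attached to `w` (with word read right to left). -/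
noncomputable def T (n : ℕ) (w : Equiv.Perm (Fin n)) : NC (n - 1) :=
  if h : ∃ i, Desc w i then nt (n - 1) h.choose * T n (w * sw h.choose) else 1
termination_by inversions n w
decreasing_by
  have := inv_desc w h.choose h.choose_spec
  omega

lemma T_one (n : ℕ) : T n 1 = 1 := by
  rw [T, dif_neg]
  rintro ⟨i, hi'⟩
  unfold Desc at hi'
  simp [Fin.lt_def, lo_val, hi_val] at hi'

lemma T_exists {n : ℕ} (w : Equiv.Perm (Fin n)) (h : ∃ i, Desc w i) :
    ∃ j, Desc w j ∧ T n w = nt (n - 1) j * T n (w * sw j) := by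
  refine ⟨h.choose, h.choose_spec, ?_⟩
  conv_lhs => rw [T, dif_pos h]

lemma sw_comm {n : ℕ} (i j : Fin (n - 1)) (h : (i : ℕ) + 2 ≤ (j : ℕ) ∨ (j : ℕ) + 2 ≤ (i : ℕ)) :
    (sw i : Equiv.Perm (Fin n)) * sw j = sw j * sw i := by
  ext p
  simp only [Equiv.Perm.mul_apply, sw_val]
  split_ifs <;> omega

lemma sw_braid {n : ℕ} (i j : Fin (n - 1)) (h : (j : ℕ) = (i : ℕ) + 1) :
    (sw i : Equiv.Perm (Fin n)) * sw j * sw i = sw j * sw i * sw j := by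
  have e0 : (lo j : Fin n) = hi i := by ext; simp [lo_val, hi_val, h]
  have h1 : (lo i : Fin n) ≠ hi i := lo_ne_hi i
  have h2 : (hi i : Fin n) ≠ hi j := by rw [← e0]; exact lo_ne_hi j
  have h3 : (lo i : Fin n) ≠ hi j := by
    rw [Ne, Fin.ext_iff, lo_val, hi_val]; omega
  unfold sw
  rw [e0, Equiv.swap_mul_swap_mul_swap h1 h3, Equiv.swap_comm (lo i), Equiv.swap_comm (hi i) (hi j),
    Equiv.swap_mul_swap_mul_swap h2.symm h3.symm, Equiv.swap_comm]

lemma desc_far {n : ℕ} (w : Equiv.Perm (Fin n)) (i j : Fin (n - 1))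
    (h : (i : ℕ) + 2 ≤ (j : ℕ) ∨ (j : ℕ) + 2 ≤ (i : ℕ)) (hd : Desc w i) : Desc (w * sw j) i := by
  unfold Desc at *
  have h1 : sw j (lo i) = lo i := by
    ext; rw [sw_val, lo_val]; split_ifs <;> omega
  have h2 : sw j (hi i) = hi i := by
    ext; rw [sw_val, hi_val]; split_ifs <;> omega
  rw [Equiv.Perm.mul_apply, Equiv.Perm.mul_apply, h1, h2]
  exact hd

lemma desc_braid {n : ℕ} (w : Equiv.Perm (Fin n)) (i j : Fin (n - 1))
    (h : (j : ℕ) = (i : ℕ) + 1) (hdi : Desc w i) (hdj : Desc w j) :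
    Desc (w * sw i) j ∧ Desc (w * sw i * sw j) i ∧ Desc (w * sw j) i ∧
      Desc (w * sw j * sw i) j := by
  unfold Desc at *
  have e0 : (lo j : Fin n) = hi i := by ext; simp [lo_val, hi_val, h]
  have e1 : sw j (lo i) = lo i := by
    ext; rw [sw_val, lo_val]; split_ifs <;> omega
  have e2 : sw j (hi i) = hi j := by rw [← e0]; simp [sw]
  have e3 : sw j (hi j) = hi i := by rw [← e0]; simp [sw]
  have e4 : sw i (hi j) = hi j := by
    ext; rw [sw_val, hi_val]; split_ifs <;> omega
  have e5 : sw i (hi i) = lo i := by simp [sw]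
  have e6 : sw i (lo i) = hi i := by simp [sw]
  simp only [Equiv.Perm.mul_apply, e0, e1, e2, e3, e4, e5, e6] at *
  exact ⟨hdj.trans hdi, hdj, hdj.trans hdi, hdi⟩

theorem T_desc {n : ℕ} (d : ℕ) : ∀ (w : Equiv.Perm (Fin n)) (i : Fin (n - 1)),
    inversions n w = d → Desc w i → T n w = nt (n - 1) i * T n (w * sw i) := by
  induction d using Nat.strong_induction_on with
  | _ d ih =>
  intro w i hd hi'
  obtain ⟨j, hj, hT⟩ := T_exists w ⟨i, hi'⟩
  have li := inv_desc w i hi'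
  have lj := inv_desc w j hj
  have braidcase : ∀ i j : Fin (n - 1), (j : ℕ) = i + 1 → Desc w i → Desc w j →
      nt (n - 1) i * T n (w * sw i) = nt (n - 1) j * T n (w * sw j) := by
    intro i j hij hdi hdj
    obtain ⟨h1, h2, h3, h4⟩ := desc_braid w i j hij hdi hdj
    have li := inv_desc w i hdi
    have lj := inv_desc w j hdj
    have l1 := inv_desc _ _ h1
    have l3 := inv_desc _ _ h3
    rw [ih _ (by omega) _ j rfl h1, ih _ (by omega) _ i rfl h3,
      ih _ (by omega) _ i rfl h2, ih _ (by omega) _ j rfl h4]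
    have e : w * sw i * sw j * sw i = w * sw j * sw i * sw j := by
      have := sw_braid i j hij
      rw [mul_assoc w, mul_assoc w, this]
      simp only [mul_assoc]
    rw [e, ← mul_assoc, ← mul_assoc, nt_braid _ i j hij]
    simp only [mul_assoc]
  rw [hT]
  rcases Nat.lt_trichotomy (i : ℕ) j with hlt | heq | hlt
  · by_cases h1 : (j : ℕ) = i + 1
    · exact (braidcase i j h1 hi' hj).symm
    · have hf : (i : ℕ) + 2 ≤ j ∨ (j : ℕ) + 2 ≤ i := by omega
      rw [ih _ (by omega) _ i rfl (desc_far w i j hf hi'),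
        ih _ (by omega) _ j rfl (desc_far w j i hf.symm hj), mul_assoc w, mul_assoc w,
        sw_comm i j hf, ← mul_assoc, nt_comm _ j i hf.symm, mul_assoc]
  · have : i = j := Fin.ext heq
    rw [this]
  · by_cases h1 : (i : ℕ) = j + 1
    · exact braidcase j i h1 hj hi'
    · have hf : (i : ℕ) + 2 ≤ j ∨ (j : ℕ) + 2 ≤ i := by omega
      rw [ih _ (by omega) _ i rfl (desc_far w i j hf hi'),
        ih _ (by omega) _ j rfl (desc_far w j i hf.symm hj), mul_assoc w, mul_assoc w,
        sw_comm i j hf, ← mul_assoc, nt_comm _ j i hf.symm, mul_assoc]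

lemma nt_mul_T {n : ℕ} (i : Fin (n - 1)) (w : Equiv.Perm (Fin n)) :
    nt (n - 1) i * T n w = 0 ∨ nt (n - 1) i * T n w = T n (w * sw i) := by
  by_cases h : Desc w i
  · left
    rw [T_desc _ w i rfl h, ← mul_assoc, nt_sq, zero_mul]
  · right
    rw [T_desc _ _ i rfl (desc_or w i h), mul_sw_sw]

lemma adjoin_nt (m : ℕ) : Algebra.adjoin ℚ (Set.range (nt m)) = ⊤ := by
  have h := congrArg (Subalgebra.map (RingQuot.mkAlgHom ℚ (NCRel m)))
    (FreeAlgebra.adjoin_range_ι ℚ (Fin m))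
  rw [AlgHom.map_adjoin, ← Set.range_comp, Algebra.map_top,
    (AlgHom.range_eq_top _).2 (RingQuot.mkAlgHom_surjective ℚ (NCRel m))] at h
  exact h

theorem span_T (n : ℕ) : Submodule.span ℚ (Set.range (T n)) = ⊤ := by
  rw [eq_top_iff]
  have key : ∀ a : NC (n - 1), ∀ b ∈ Submodule.span ℚ (Set.range (T n)),
      a * b ∈ Submodule.span ℚ (Set.range (T n)) := by
    intro a
    have ha : a ∈ Algebra.adjoin ℚ (Set.range (nt (n - 1))) := by
      rw [adjoin_nt]; trivial
    induction ha using Algebra.adjoin_induction with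
    | mem a ha =>
      obtain ⟨i, rfl⟩ := ha
      intro b hb
      induction hb using Submodule.span_induction with
      | mem b hb =>
        obtain ⟨w, rfl⟩ := hb
        rcases nt_mul_T i w with h | h
        · rw [h]; exact Submodule.zero_mem _
        · rw [h]; exact Submodule.subset_span ⟨_, rfl⟩
      | zero => rw [mul_zero]; exact Submodule.zero_mem _
      | add b c _ _ hb hc => rw [mul_add]; exact Submodule.add_mem _ hb hc
      | smul r b _ hb => rw [mul_smul_comm]; exact Submodule.smul_mem _ _ hb
    | algebraMap r =>
      intro b hb
      rw [← Algebra.smul_def]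
      exact Submodule.smul_mem _ _ hb
    | add a c _ _ ha hc =>
      intro b hb
      rw [add_mul]
      exact Submodule.add_mem _ (ha b hb) (hc b hb)
    | mul a c _ _ ha hc =>
      intro b hb
      rw [mul_assoc]
      exact ha _ (hc b hb)
  intro a _
  have := key a 1 (Submodule.subset_span ⟨1, T_one n⟩)
  rwa [mul_one] at this

/-! ### The homomorphism to the Fomin–Kirillov algebra -/

lemma x_antisymm (n : ℕ) (i j : Fin n) (h : i ≠ j) : x n j i = - x n i j := by
  have := RingQuot.mkAlgHom_rel ℚ (Rel.antisymm i j h)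
  simpa [x] using this

lemma x_diag (n : ℕ) (i : Fin n) : x n i i = 0 := by
  have := RingQuot.mkAlgHom_rel ℚ (Rel.diag i)
  simpa [x] using this

lemma x_sq (n : ℕ) (i j : Fin n) (h : i ≠ j) : x n i j * x n i j = 0 := by
  have := RingQuot.mkAlgHom_rel ℚ (Rel.square i j h)
  simpa [x] using this

lemma x_comm (n : ℕ) (i j k l : Fin n) (h : List.Nodup [i, j, k, l]) :
    x n i j * x n k l = x n k l * x n i j := by
  have := RingQuot.mkAlgHom_rel ℚ (Rel.comm i j k l h)
  simpa [x] using this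

lemma x_cyclic (n : ℕ) (i j k : Fin n) (h : List.Nodup [i, j, k]) :
    x n i j * x n j k + x n j k * x n k i + x n k i * x n i j = 0 := by
  have := RingQuot.mkAlgHom_rel ℚ (Rel.cyclic i j k h)
  simpa [x] using this

lemma x_braid (n : ℕ) (i j k : Fin n) (h : List.Nodup [i, j, k]) :
    x n i j * x n j k * x n i j = x n j k * x n i j * x n j k := by
  have hc := x_cyclic n i j k h
  simp only [List.nodup_cons, List.mem_cons, List.not_mem_nil, or_false, not_or] at h
  have h1 := x_sq n i j h.1.1
  have h2 := x_sq n j k h.2.1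
  set a := x n i j
  set b := x n j k
  set c := x n k i
  have e1 : (a * b + b * c + c * a) * a = 0 := by rw [hc, zero_mul]
  have e2 : b * (a * b + b * c + c * a) = 0 := by rw [hc, mul_zero]
  have e1' : a * b * a + b * c * a = 0 := by
    have : (a * b + b * c + c * a) * a = a * b * a + b * c * a + c * (a * a) := by noncomm_ring
    rw [this, h1, mul_zero, add_zero] at e1
    exact e1
  have e2' : b * a * b + b * c * a = 0 := by
    have : b * (a * b + b * c + c * a) = b * a * b + (b * b) * c + b * c * a := by noncomm_ring
    rw [this, h2, zero_mul, add_zero] at e2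
    exact e2
  exact add_right_cancel (e1'.trans e2'.symm)

/-- The homomorphism `N_n → E_n`. -/
noncomputable def phi (n : ℕ) : NC (n - 1) →ₐ[ℚ] E n :=
  RingQuot.liftAlgHom ℚ ⟨FreeAlgebra.lift ℚ fun i : Fin (n - 1) => x n (lo i) (hi i), by
    intro a b hab
    cases hab with
    | square i =>
      simp only [map_mul, FreeAlgebra.lift_ι_apply, map_zero]
      exact x_sq n _ _ (lo_ne_hi i)
    | comm i j h =>
      simp only [map_mul, FreeAlgebra.lift_ι_apply]
      apply x_comm
      simp only [List.nodup_cons, List.mem_cons, List.not_mem_nil, or_false, not_or,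
        Fin.ext_iff, lo_val, hi_val, not_false_eq_true, List.nodup_nil, and_true]
      omega
    | braid i j h =>
      simp only [map_mul, FreeAlgebra.lift_ι_apply]
      have e0 : (lo j : Fin n) = hi i := by ext; simp [lo_val, hi_val, h]
      rw [e0]
      apply x_braid
      simp only [List.nodup_cons, List.mem_cons, List.not_mem_nil, or_false, not_or,
        Fin.ext_iff, lo_val, hi_val, not_false_eq_true, List.nodup_nil, and_true]
      omega⟩

lemma phi_nt (n : ℕ) (i : Fin (n - 1)) : phi n (nt (n - 1) i) = x n (lo i) (hi i) := by
  simp [phi, nt]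

lemma phi_range (n : ℕ) : (phi n).range = EG n (pathA n) := by
  rw [← Algebra.map_top, ← adjoin_nt, AlgHom.map_adjoin]
  apply le_antisymm
  · apply Algebra.adjoin_mono
    rintro _ ⟨_, ⟨i, rfl⟩, rfl⟩
    refine ⟨lo i, hi i, ?_, phi_nt n i⟩
    rw [pathA, SimpleGraph.fromRel_adj]
    exact ⟨lo_ne_hi i, Or.inl rfl⟩
  · apply Algebra.adjoin_le
    have key : ∀ i j : Fin n, (j : ℕ) = i + 1 →
        x n i j ∈ Algebra.adjoin ℚ (phi n '' Set.range (nt (n - 1))) := by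
      intro i j h
      apply Algebra.subset_adjoin
      refine ⟨_, ⟨⟨i, by have := j.2; omega⟩, rfl⟩, ?_⟩
      rw [phi_nt]
      congr 1
      exact Fin.ext h.symm
    rintro _ ⟨i, j, hij, rfl⟩
    rw [pathA, SimpleGraph.fromRel_adj] at hij
    rcases hij.2 with h | h
    · exact key i j h
    · rw [x_antisymm n j i hij.1.symm]
      exact Subalgebra.neg_mem _ (key j i h)

/-! ### Divided differences at a generic point -/

/-- Divided difference operators on functions on the orbit of the point `(0,…,n-1)`. -/
noncomputable def D (n : ℕ) (i j : Fin n) :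
    Module.End ℚ (Equiv.Perm (Fin n) → ℚ) where
  toFun F w := (F w - F (w * Equiv.swap i j)) / (((w i : Fin n) : ℕ) - ((w j : Fin n) : ℕ) : ℚ)
  map_add' F G := by
    ext w
    simp only [Pi.add_apply]
    ring
  map_smul' r F := by
    ext w
    simp only [Pi.smul_apply, smul_eq_mul, RingHom.id_apply]
    ring

lemma D_apply (n : ℕ) (i j : Fin n) (F : Equiv.Perm (Fin n) → ℚ) (w : Equiv.Perm (Fin n)) :
    D n i j F w =
      (F w - F (w * Equiv.swap i j)) / (((w i : Fin n) : ℕ) - ((w j : Fin n) : ℕ) : ℚ) := rfl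

lemma sub_ne {n : ℕ} (w : Equiv.Perm (Fin n)) {i j : Fin n} (h : i ≠ j) :
    (((w i : Fin n) : ℕ) - ((w j : Fin n) : ℕ) : ℚ) ≠ 0 := by
  rw [sub_ne_zero]
  intro he
  exact h (w.injective (Fin.ext (by exact_mod_cast he)))

lemma D_antisymm (n : ℕ) (i j : Fin n) : D n j i = - D n i j := by
  refine LinearMap.ext fun F => funext fun w => ?_
  rw [LinearMap.neg_apply, Pi.neg_apply, D_apply, D_apply, Equiv.swap_comm, ← div_neg, neg_sub]

lemma D_sq (n : ℕ) (i j : Fin n) : D n i j * D n i j = 0 := by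
  refine LinearMap.ext fun F => funext fun w => ?_
  rw [Module.End.mul_apply, D_apply, D_apply, D_apply, mul_assoc, Equiv.swap_mul_self, mul_one,
    Equiv.Perm.mul_apply, Equiv.Perm.mul_apply, Equiv.swap_apply_left, Equiv.swap_apply_right,
    ← neg_sub (((w i : Fin n) : ℕ) : ℚ), ← neg_sub (F w), neg_div_neg_eq, sub_self, zero_div]
  rfl

lemma D_comm (n : ℕ) (i j k l : Fin n) (h : List.Nodup [i, j, k, l]) :
    D n i j * D n k l = D n k l * D n i j := by
  simp only [List.nodup_cons, List.mem_cons, List.not_mem_nil, or_false, not_or,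
    not_false_eq_true, List.nodup_nil, and_true] at h
  obtain ⟨⟨hij, hik, hil⟩, ⟨hjk, hjl⟩, hkl⟩ := h
  refine LinearMap.ext fun F => funext fun w => ?_
  have e : Equiv.swap i j * Equiv.swap k l = Equiv.swap k l * Equiv.swap i j := by
    ext p
    simp only [Equiv.Perm.mul_apply, Equiv.swap_apply_def]
    grind
  simp only [Module.End.mul_apply, D_apply, Equiv.Perm.mul_apply, mul_assoc, e,
    Equiv.swap_apply_of_ne_of_ne (Ne.symm hik) (Ne.symm hjk),
    Equiv.swap_apply_of_ne_of_ne (Ne.symm hil) (Ne.symm hjl),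
    Equiv.swap_apply_of_ne_of_ne hik hil, Equiv.swap_apply_of_ne_of_ne hjk hjl]
  have h1 := sub_ne w hij
  have h2 := sub_ne w hkl
  field_simp
  ring

lemma D_cyclic (n : ℕ) (i j k : Fin n) (h : List.Nodup [i, j, k]) :
    D n i j * D n j k + D n j k * D n k i + D n k i * D n i j = 0 := by
  simp only [List.nodup_cons, List.mem_cons, List.not_mem_nil, or_false, not_or,
    not_false_eq_true, List.nodup_nil, and_true] at h
  obtain ⟨⟨hij, hik⟩, hjk⟩ := h
  refine LinearMap.ext fun F => funext fun w => ?_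
  have e1 : Equiv.swap j k * Equiv.swap k i = Equiv.swap i j * Equiv.swap j k := by
    ext p
    simp only [Equiv.Perm.mul_apply, Equiv.swap_apply_def]
    grind
  have e2 : Equiv.swap k i * Equiv.swap i j = Equiv.swap i j * Equiv.swap j k := by
    ext p
    simp only [Equiv.Perm.mul_apply, Equiv.swap_apply_def]
    grind
  simp only [LinearMap.add_apply, Pi.add_apply, LinearMap.zero_apply, Pi.zero_apply,
    Module.End.mul_apply, D_apply, Equiv.Perm.mul_apply, mul_assoc, e1, e2,
    Equiv.swap_apply_left, Equiv.swap_apply_right,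
    Equiv.swap_apply_of_ne_of_ne hij hik, Equiv.swap_apply_of_ne_of_ne (Ne.symm hik) (Ne.symm hjk),
    Equiv.swap_apply_of_ne_of_ne hjk (Ne.symm hij)]
  have h1 := sub_ne w hij
  have h2 := sub_ne w hjk
  have h3 := sub_ne w (Ne.symm hik)
  have h1' := sub_ne w (Ne.symm hij)
  have h2' := sub_ne w (Ne.symm hjk)
  have h3' := sub_ne w hik
  generalize F (w * (Equiv.swap i j * Equiv.swap j k)) = f0
  generalize F (w * Equiv.swap i j) = f1
  generalize F (w * Equiv.swap j k) = f2
  generalize F (w * Equiv.swap k i) = f3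
  generalize (((w i : Fin n) : ℕ) : ℚ) = a at *
  generalize (((w j : Fin n) : ℕ) : ℚ) = b at *
  generalize (((w k : Fin n) : ℕ) : ℚ) = c at *
  rw [← neg_sub a b, ← neg_sub b c, ← neg_sub c a]
  field_simp
  ring

/-- The representation of `E n` by divided differences. -/
noncomputable def rho (n : ℕ) : E n →ₐ[ℚ] Module.End ℚ (Equiv.Perm (Fin n) → ℚ) :=
  RingQuot.liftAlgHom ℚ ⟨FreeAlgebra.lift ℚ fun p : Fin n × Fin n => D n p.1 p.2, by
    intro a b hab
    cases hab with
    | diag i =>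
      simp only [FreeAlgebra.lift_ι_apply, map_zero]
      refine LinearMap.ext fun F => funext fun w => ?_
      simp [D_apply]
    | antisymm i j h =>
      simp only [map_neg, FreeAlgebra.lift_ι_apply]
      exact D_antisymm n i j
    | square i j h =>
      simp only [map_mul, FreeAlgebra.lift_ι_apply, map_zero]
      exact D_sq n i j
    | comm i j k l h =>
      simp only [map_mul, FreeAlgebra.lift_ι_apply]
      exact D_comm n i j k l h
    | cyclic i j k h =>
      simp only [map_mul, map_add, FreeAlgebra.lift_ι_apply, map_zero]
      exact D_cyclic n i j k h⟩

lemma rho_x (n : ℕ) (i j : Fin n) : rho n (x n i j) = D n i j := by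
  simp [rho, x]

/-- The image of `T w` acting on the delta function at the identity. -/
noncomputable def G (n : ℕ) (w : Equiv.Perm (Fin n)) : Equiv.Perm (Fin n) → ℚ :=
  rho n (phi n (T n w)) (Pi.single 1 1)

lemma G_desc {n : ℕ} (w : Equiv.Perm (Fin n)) (i : Fin (n - 1)) (h : Desc w i) :
    G n w = D n (lo i) (hi i) (G n (w * sw i)) := by
  rw [G, T_desc _ w i rfl h, map_mul, map_mul, phi_nt, rho_x, Module.End.mul_apply]
  rfl

lemma G_tri {n : ℕ} (d : ℕ) : ∀ w : Equiv.Perm (Fin n), inversions n w = d →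
    G n w w ≠ 0 ∧ ∀ v, G n w v ≠ 0 → v = w ∨ inversions n v < d := by
  induction d using Nat.strong_induction_on with
  | _ d ih =>
  intro w hd
  by_cases h : ∃ i, Desc w i
  · obtain ⟨i, hi'⟩ := h
    have li := inv_desc w i hi'
    obtain ⟨h1, h2⟩ := ih _ (by omega) (w * sw i) rfl
    have hne := lo_ne_hi i
    rw [G_desc w i hi']
    constructor
    · rw [D_apply]
      have h0 : G n (w * sw i) w = 0 := by
        by_contra hc
        rcases h2 w hc with he | he
        · rw [← he] at li; omega
        · omega
      rw [h0, zero_sub]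
      exact div_ne_zero (neg_ne_zero.2 h1) (sub_ne w hne)
    · intro v hv
      rw [D_apply] at hv
      have hv' : G n (w * sw i) v ≠ 0 ∨ G n (w * sw i) (v * sw i) ≠ 0 := by
        by_contra hc
        push Not at hc
        apply hv
        change (_ - G n (w * sw i) (v * sw i)) / _ = _
        rw [hc.1, hc.2, sub_zero, zero_div]
      rcases hv' with hv' | hv'
      · right
        rcases h2 v hv' with he | he
        · rw [he]; omega
        · omega
      · rcases h2 _ hv' with he | he
        · left; exact mul_right_cancel he
        · right
          have := inv_le v i
          omega
  · have h1 := eq_one_of_no_desc w h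
    subst h1
    have : G n 1 = Pi.single 1 1 := by
      rw [G, T_one, map_one, map_one]; rfl
    rw [this]
    refine ⟨by simp, ?_⟩
    intro v hv
    left
    by_contra hc
    exact hv (Pi.single_eq_of_ne hc _)

theorem linInd_G (n : ℕ) : LinearIndependent ℚ (G n) := by
  rw [Fintype.linearIndependent_iff]
  intro g hg
  by_contra hc
  push Not at hc
  obtain ⟨w0, hw0⟩ := hc
  obtain ⟨w, hw, hmax⟩ := Finset.exists_max_image
    (Finset.univ.filter fun w : Equiv.Perm (Fin n) => g w ≠ 0) (inversions n) ⟨w0, by simp [hw0]⟩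
  simp only [Finset.mem_filter, Finset.mem_univ, true_and] at hw hmax
  have h := congrFun hg w
  rw [Finset.sum_apply, Finset.sum_eq_single w] at h
  · simp only [Pi.smul_apply, smul_eq_mul, Pi.zero_apply, mul_eq_zero] at h
    exact h.elim hw (G_tri _ w rfl).1
  · intro u _ hu
    by_contra hc
    simp only [Pi.smul_apply, smul_eq_mul, mul_eq_zero, not_or] at hc
    have := hmax u hc.1
    rcases (G_tri _ u rfl).2 w hc.2 with he | he
    · exact hu he.symm
    · omega
  · simp

theorem linInd_phiT (n : ℕ) : LinearIndependent ℚ (fun w => phi n (T n w)) := by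
  let ev : E n →ₗ[ℚ] (Equiv.Perm (Fin n) → ℚ) :=
    (LinearMap.applyₗ (Pi.single 1 1 : Equiv.Perm (Fin n) → ℚ)).comp (rho n).toLinearMap
  exact LinearIndependent.of_comp ev (linInd_G n)

theorem phi_injective (n : ℕ) : Function.Injective (phi n) := by
  rw [injective_iff_map_eq_zero]
  intro a ha
  have hmem : a ∈ Submodule.span ℚ (Set.range (T n)) := by rw [span_T]; trivial
  obtain ⟨c, rfl⟩ := (Submodule.mem_span_range_iff_exists_fun ℚ).1 hmem
  rw [map_sum] at ha
  simp only [map_smul] at ha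
  have := Fintype.linearIndependent_iff.1 (linInd_phiT n) c ha
  simp [this]

lemma EG_span (n : ℕ) : (EG n (pathA n)).toSubmodule =
    Submodule.span ℚ (Set.range fun w => phi n (T n w)) := by
  have h : (EG n (pathA n)).toSubmodule = Submodule.map (phi n).toLinearMap ⊤ := by
    rw [← phi_range]
    ext y
    simp
  rw [h, ← span_T, Submodule.map_span, ← Set.range_comp]
  rfl

/-! ### The grading -/

/-- The scaling endomorphism multiplying each generator by `2`. -/
noncomputable def psi (n : ℕ) : E n →ₐ[ℚ] E n :=
  RingQuot.liftAlgHom ℚ ⟨FreeAlgebra.lift ℚ fun p : Fin n × Fin n => (2 : ℚ) • x n p.1 p.2, by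
    intro a b hab
    cases hab with
    | diag i =>
      simp only [FreeAlgebra.lift_ι_apply, map_zero, x_diag, smul_zero]
    | antisymm i j h =>
      simp only [map_neg, FreeAlgebra.lift_ι_apply]
      rw [x_antisymm n i j h, smul_neg]
    | square i j h =>
      simp only [map_mul, FreeAlgebra.lift_ι_apply, map_zero]
      rw [smul_mul_smul_comm, x_sq n i j h, smul_zero]
    | comm i j k l h =>
      simp only [map_mul, FreeAlgebra.lift_ι_apply]
      rw [smul_mul_smul_comm, smul_mul_smul_comm, x_comm n i j k l h]
    | cyclic i j k h =>
      simp only [map_mul, map_add, FreeAlgebra.lift_ι_apply, map_zero]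
      rw [smul_mul_smul_comm, smul_mul_smul_comm, smul_mul_smul_comm, ← smul_add, ← smul_add,
        x_cyclic n i j k h, smul_zero]⟩

lemma psi_x (n : ℕ) (i j : Fin n) : psi n (x n i j) = (2 : ℚ) • x n i j := by
  simp [psi, x]

lemma psi_word (n : ℕ) (l : List (Fin n × Fin n)) :
    psi n (word n l) = (2 : ℚ) ^ l.length • word n l := by
  induction l with
  | nil => simp [word]
  | cons p l ih =>
    have h : word n (p :: l) = x n p.1 p.2 * word n l := by simp [word]
    rw [h, map_mul, ih, psi_x, smul_mul_smul_comm, List.length_cons, pow_succ']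

lemma psi_deg (n d : ℕ) (y : E n) (hy : y ∈ degSpan n d) : psi n y = (2 : ℚ) ^ d • y := by
  unfold degSpan at hy
  induction hy using Submodule.span_induction with
  | mem y hy =>
    obtain ⟨l, _, rfl, rfl⟩ := hy
    exact psi_word n l
  | zero => simp
  | add a b _ _ ha hb => rw [map_add, ha, hb, smul_add]
  | smul r a _ ha => rw [map_smul, ha, smul_comm]

lemma T_deg {n : ℕ} (d : ℕ) : ∀ w : Equiv.Perm (Fin n), inversions n w = d →
    phi n (T n w) ∈ degSpan n d := by
  suffices H : ∀ w : Equiv.Perm (Fin n), inversions n w = d →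
      ∃ l : List (Fin n × Fin n), (∀ p ∈ l, p.1 ≠ p.2) ∧ l.length = d ∧
        phi n (T n w) = word n l from
    fun w hw => Submodule.subset_span (H w hw)
  induction d with
  | zero =>
    intro w hw
    have : w = 1 := by
      apply eq_one_of_no_desc
      rintro ⟨i, h⟩
      have := inv_desc w i h
      omega
    exact ⟨[], by simp, rfl, by rw [this, T_one, map_one]; simp [word]⟩
  | succ d ih =>
    intro w hw
    by_cases h : ∃ i, Desc w i
    · obtain ⟨i, h⟩ := h
      have li := inv_desc w i h
      obtain ⟨l, h1, h2, h3⟩ := ih (w * sw i) (by omega)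
      refine ⟨(lo i, hi i) :: l, ?_, by simp [h2], ?_⟩
      · intro p hp
        rcases List.mem_cons.1 hp with rfl | hp
        · exact lo_ne_hi i
        · exact h1 p hp
      · rw [T_desc _ w i rfl h, map_mul, h3, phi_nt]
        simp [word]
    · have h1 := eq_one_of_no_desc w h
      exfalso
      rw [h1] at hw
      have h0 : inversions n 1 = 0 := by
        unfold inversions
        rw [Finset.card_eq_zero, Finset.filter_eq_empty_iff]
        rintro p _ ⟨ha, hb⟩
        exact lt_asymm ha hb
      omega

lemma EGdeg_span (n d : ℕ) : EGdeg n (pathA n) d =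
    Submodule.span ℚ (Set.range fun w : {w : Equiv.Perm (Fin n) // inversions n w = d} =>
      phi n (T n w.1)) := by
  apply le_antisymm
  · rintro y ⟨hy1, hy2⟩
    rw [SetLike.mem_coe, EG_span] at hy1
    obtain ⟨c, rfl⟩ := (Submodule.mem_span_range_iff_exists_fun ℚ).1 hy1
    have h := psi_deg n d _ hy2
    rw [map_sum, Finset.smul_sum, ← sub_eq_zero, ← Finset.sum_sub_distrib] at h
    have h' : ∑ w : Equiv.Perm (Fin n),
        (c w * ((2 : ℚ) ^ inversions n w - 2 ^ d)) • phi n (T n w) = 0 := by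
      rw [← h]
      refine Finset.sum_congr rfl fun w _ => ?_
      rw [map_smul, psi_deg n _ _ (T_deg _ w rfl), smul_smul, smul_smul, ← sub_smul]
      congr 1
      ring
    have h2 := Fintype.linearIndependent_iff.1 (linInd_phiT n) _ h'
    refine Submodule.sum_mem _ fun w _ => ?_
    by_cases hw : inversions n w = d
    · exact Submodule.smul_mem _ _ (Submodule.subset_span ⟨⟨w, hw⟩, rfl⟩)
    · have hc : c w = 0 := by
        rcases mul_eq_zero.1 (h2 w) with h | h
        · exact h
        · exact absurd (pow_right_injective₀ (by norm_num) (by norm_num) (sub_eq_zero.1 h)) hw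
      rw [hc, zero_smul]
      exact Submodule.zero_mem _
  · rw [Submodule.span_le]
    rintro _ ⟨⟨w, hw⟩, rfl⟩
    refine ⟨?_, T_deg d w hw⟩
    rw [SetLike.mem_coe, EG_span]
    exact Submodule.subset_span ⟨w, rfl⟩

/-- the `ℚ`-algebra homomorphism from the nil-Coxeter algebra `N_n` (of type
`A_{n-1}`, with `n-1` generators) to `E_{A_n}` sending `t_i ↦ x_{i,i+1}` exists and is an
isomorphism onto `E_{A_n}`; in particular `dim E_{A_n}^d` is the number of permutations of
`{1,…,n}` with exactly `d` inversions, and `dim E_{A_n} = n!`. -/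
theorem stmt18 (n : ℕ) (hn : 2 ≤ n) :
    (∃ φ : NC (n - 1) →ₐ[ℚ] E n,
      (∀ i : Fin (n - 1),
        φ (nt (n - 1) i) =
          x n ⟨(i : ℕ), by have := i.2; omega⟩ ⟨(i : ℕ) + 1, by have := i.2; omega⟩) ∧
      Function.Injective φ ∧
      φ.range = EG n (pathA n)) ∧
    (∀ d : ℕ, Module.finrank ℚ ↥(EGdeg n (pathA n) d) =
      (Finset.univ.filter fun σ : Equiv.Perm (Fin n) => inversions n σ = d).card) ∧
    Module.finrank ℚ ↥(EG n (pathA n)) = n.factorial := by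
  refine ⟨⟨phi n, fun i => phi_nt n i, phi_injective n, phi_range n⟩, ?_, ?_⟩
  · intro d
    have hl : LinearIndependent ℚ
        (fun w : {w : Equiv.Perm (Fin n) // inversions n w = d} => phi n (T n w.1)) :=
      (linInd_phiT n).comp Subtype.val Subtype.val_injective
    rw [EGdeg_span, finrank_span_eq_card hl, Fintype.card_subtype]
  · change Module.finrank ℚ ↥(EG n (pathA n)).toSubmodule = _
    rw [EG_span, finrank_span_eq_card (linInd_phiT n), Fintype.card_perm, Fintype.card_fin]

end FK
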